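/- arXiv:1404.0187 — 5 statements merged into one kernel-verified Lean document; each statement's English description precedes it below -/
import Mathlib

section
/- A positive integer z can be written as a sum of two nonzero squares if and only if (i) every prime q with q ≡ 3 (mod 4) dividing z occurs to an even exponent in the prime factorization of z, and (ii) whenever z is a perfect square, say z = c^2 with c a positive integer, there exist integers k > 0 and u > v > 0 of opposite parity with gcd(u,v) = 1 such that c = (u^2 + v^2)·k. -/
/-- The hypotenuse of a nondegenerate Pythagorean triple is a positive multiple of `u ^ 2 + v ^ 2`
with `u > v > 0` coprime of opposite parity. -/
theorem PythagoreanTriple.exists_hypotenuse_eq {x y : ℤ} {c : ℕ} (h : PythagoreanTriple x y c)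
    (hx : x ≠ 0) (hy : y ≠ 0) :
    ∃ k u v : ℕ, 0 < k ∧ 0 < v ∧ v < u ∧ u % 2 ≠ v % 2 ∧ Nat.gcd u v = 1 ∧
      c = (u ^ 2 + v ^ 2) * k := by
  have hg : 0 < Int.gcd x y := Int.gcd_pos_of_ne_zero_left y hx
  obtain ⟨c', hc'⟩ := h.gcd_dvd
  obtain ⟨m, n, hxy, hz, hmn, hpar⟩ :=
    PythagoreanTriple.coprime_classification.mp ⟨h.normalize, Int.gcd_div_gcd_div_gcd hg⟩
  have hx' : x / (Int.gcd x y : ℤ) ≠ 0 := fun h0 ↦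
    hx (Int.eq_zero_of_ediv_eq_zero (Int.gcd_dvd_left x y) h0)
  have hy' : y / (Int.gcd x y : ℤ) ≠ 0 := fun h0 ↦
    hy (Int.eq_zero_of_ediv_eq_zero (Int.gcd_dvd_right x y) h0)
  have hm : m ≠ 0 := by rintro rfl; simp_all
  have hn : n ≠ 0 := by rintro rfl; simp_all
  have hg' : (Int.gcd x y : ℤ) ≠ 0 := by exact_mod_cast hg.ne'
  rw [hc', Int.mul_ediv_cancel_left _ hg'] at hz
  have hc : c = (m.natAbs ^ 2 + n.natAbs ^ 2) * Int.gcd x y := by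
    have hpos : 0 < m ^ 2 + n ^ 2 := by positivity
    have hc'0 : 0 ≤ c' := nonneg_of_mul_nonneg_right (hc' ▸ Int.natCast_nonneg c)
      (by exact_mod_cast hg)
    have hc'_eq : c' = m ^ 2 + n ^ 2 := by omega
    zify
    rw [sq_abs, sq_abs, hc', hc'_eq, mul_comm]
  have hpar' : m.natAbs % 2 ≠ n.natAbs % 2 := by omega
  rcases lt_or_gt_of_ne (fun h0 ↦ hpar' (congrArg (· % 2) h0)) with hlt | hlt
  · exact ⟨_, n.natAbs, m.natAbs, hg, Int.natAbs_pos.mpr hm, hlt, hpar'.symm,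
      (Nat.gcd_comm _ _).trans hmn, by rw [hc, add_comm]⟩
  · exact ⟨_, m.natAbs, n.natAbs, hg, Int.natAbs_pos.mpr hn, hlt, hpar', hmn, hc⟩

/-- Euclid's formula: the square of a multiple of `u ^ 2 + v ^ 2` with `u > v > 0` is a sum of two
nonzero squares. -/
theorem exists_ne_zero_sq_add_sq_of_mul {k u v : ℕ} (hk : 0 < k) (hv : 0 < v) (huv : v < u) :
    ∃ x y : ℤ, x ≠ 0 ∧ y ≠ 0 ∧ ((((u ^ 2 + v ^ 2) * k) ^ 2 : ℕ) : ℤ) = x ^ 2 + y ^ 2 := by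
  refine ⟨k * (u ^ 2 - v ^ 2), 2 * k * u * v, ?_, ?_, by push_cast; ring⟩
  · have hlt : (v : ℤ) ^ 2 < u ^ 2 := by exact_mod_cast Nat.pow_lt_pow_left huv two_ne_zero
    exact mul_ne_zero (by exact_mod_cast hk.ne') (sub_pos.mpr hlt).ne'
  · have hu : 0 < u := hv.trans huv
    positivity


/-- A positive integer `z` is a sum of two nonzero squares iff every prime `q ≡ 3 (mod 4)`
dividing `z` occurs to an even exponent in `z`, and whenever `z = c^2` is a perfect square,
`c = (u^2 + v^2) * k` for some `k > 0` and `u > v > 0` of opposite parity with `gcd(u,v) = 1`. -/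
theorem sum_two_nonzero_squares_iff_pythagorean (z : ℕ) (hz : 0 < z) :
    (∃ x y : ℤ, x ≠ 0 ∧ y ≠ 0 ∧ (z : ℤ) = x ^ 2 + y ^ 2) ↔
      ((∀ q : ℕ, q.Prime → q % 4 = 3 → q ∣ z → Even (z.factorization q)) ∧
        (∀ c : ℕ, 0 < c → z = c ^ 2 →
          ∃ k u v : ℕ, 0 < k ∧ 0 < v ∧ v < u ∧ u % 2 ≠ v % 2 ∧ Nat.gcd u v = 1 ∧
            c = (u ^ 2 + v ^ 2) * k)) := by
  have key : (∃ x y : ℕ, z = x ^ 2 + y ^ 2) ↔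
      ∀ q : ℕ, q.Prime → q % 4 = 3 → q ∣ z → Even (z.factorization q) := by
    rw [Nat.eq_sq_add_sq_iff]
    refine ⟨fun H q hq h3 hd ↦ ?_, fun H q hq h3 ↦ ?_⟩
    · rw [Nat.factorization_def z hq]
      exact H q (Nat.mem_primeFactors.mpr ⟨hq, hd, hz.ne'⟩) h3
    · have hp := Nat.prime_of_mem_primeFactors hq
      rw [← Nat.factorization_def z hp]
      exact H q hp h3 (Nat.dvd_of_mem_primeFactors hq)
  rw [← key]
  constructor
  · rintro ⟨x, y, hx, hy, h⟩
    refine ⟨⟨x.natAbs, y.natAbs, by zify; simpa only [sq_abs] using h⟩, fun c _ hzc ↦ ?_⟩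
    refine PythagoreanTriple.exists_hypotenuse_eq (x := x) (y := y) ?_ hx hy
    rw [hzc] at h
    push_cast at h
    unfold PythagoreanTriple
    linarith
  · rintro ⟨⟨x, y, h⟩, H⟩
    have square_case (c : ℕ) (hzc : z = c ^ 2) :
        ∃ x y : ℤ, x ≠ 0 ∧ y ≠ 0 ∧ (z : ℤ) = x ^ 2 + y ^ 2 := by
      have hc : 0 < c := Nat.pos_of_ne_zero (by rintro rfl; omega)
      obtain ⟨k, u, v, hk, hv, huv, -, -, rfl⟩ := H c hc hzc
      rw [hzc]
      exact exists_ne_zero_sq_add_sq_of_mul hk hv huv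
    rcases eq_or_ne x 0 with rfl | hx
    · exact square_case y (by simpa using h)
    rcases eq_or_ne y 0 with rfl | hy
    · exact square_case x (by simpa using h)
    exact ⟨x, y, by exact_mod_cast hx, by exact_mod_cast hy, by exact_mod_cast h⟩
end

section
/- A positive integer z can be written as a sum of two nonzero squares if and only if (i) every prime q with q ≡ 3 (mod 4) dividing z occurs to an even exponent in the prime factorization of z, and (ii) whenever z is a perfect square, z is divisible by some prime p with p ≡ 1 (mod 4). -/
/-- A natural number whose square is a sum of two nonzero squares has a prime factor `1` mod `4`. -/
theorem exists_prime_mod_four_eq_one_of_sq_eq_sq_add_sq {c x y : ℕ} (hx : x ≠ 0) (hy : y ≠ 0)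
    (h : c ^ 2 = x ^ 2 + y ^ 2) : ∃ p : ℕ, p.Prime ∧ p % 4 = 1 ∧ p ∣ c := by
  obtain ⟨g, a, b, hg, hab, rfl, rfl⟩ :=
    Nat.exists_coprime' (Nat.gcd_pos_of_pos_left y (Nat.pos_of_ne_zero hx))
  obtain ⟨d, rfl⟩ : g ∣ c := by
    rw [← Nat.pow_dvd_pow_iff two_ne_zero, h]
    exact ⟨a ^ 2 + b ^ 2, by ring⟩
  have ha : 0 < a ^ 2 := pow_pos (Nat.pos_of_ne_zero (left_ne_zero_of_mul hx)) 2
  have hb : 0 < b ^ 2 := pow_pos (Nat.pos_of_ne_zero (left_ne_zero_of_mul hy)) 2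
  have hd : d ^ 2 = a ^ 2 + b ^ 2 := by
    apply Nat.eq_of_mul_eq_mul_left (pow_pos hg 2)
    linarith
  have hs := ZMod.isSquare_neg_one_of_eq_sq_add_sq_of_coprime hd hab
  have hd1 : d ≠ 1 := by
    rintro rfl
    lia
  have hp := Nat.minFac_prime hd1
  have hpd := Nat.minFac_dvd d
  have h3 : d.minFac % 4 ≠ 3 :=
    Nat.mod_four_ne_three_of_mem_primeFactors_of_isSquare_neg_one
      (Nat.mem_primeFactors.mpr ⟨hp, hpd.trans (dvd_pow_self d two_ne_zero), by lia⟩) hs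
  have h2 : d.minFac ≠ 2 := by
    intro h2
    have h4 : 4 ∣ d ^ 2 := pow_dvd_pow_of_dvd (h2 ▸ hpd) 2
    have := ZMod.isSquare_neg_one_of_dvd h4 hs
    revert this
    decide
  have hodd := hp.eq_two_or_odd
  exact ⟨d.minFac, hp, by lia, hpd.mul_left g⟩

/-- The square of a prime `1` mod `4` is a sum of two nonzero squares. -/
theorem Nat.Prime.exists_sq_eq_sq_add_sq {p : ℕ} (hp : p.Prime) (h1 : p % 4 = 1) :
    ∃ x y : ℤ, x ≠ 0 ∧ y ≠ 0 ∧ (p : ℤ) ^ 2 = x ^ 2 + y ^ 2 := by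
  have : Fact p.Prime := ⟨hp⟩
  obtain ⟨a, b, rfl⟩ := Nat.Prime.sq_add_sq (p := p) (by lia)
  have ha : a ≠ 0 := by
    rintro rfl
    exact Nat.Prime.not_prime_pow le_rfl (by simpa using hp)
  have hb : b ≠ 0 := by
    rintro rfl
    exact Nat.Prime.not_prime_pow le_rfl (by simpa using hp)
  refine ⟨a ^ 2 - b ^ 2, 2 * a * b, ?_, by positivity, by push_cast; ring⟩
  intro h
  have : a ^ 2 = b ^ 2 := by exact_mod_cast sub_eq_zero.mp h
  lia

/-- A positive integer `z` is a sum of two nonzero squares iff every prime `q ≡ 3 (mod 4)`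
dividing `z` occurs to an even exponent in `z`, and whenever `z` is a perfect square,
`z` is divisible by some prime `p ≡ 1 (mod 4)`. -/
theorem sum_two_nonzero_squares_iff (z : ℕ) (hz : 0 < z) :
    (∃ x y : ℤ, x ≠ 0 ∧ y ≠ 0 ∧ (z : ℤ) = x ^ 2 + y ^ 2) ↔
      ((∀ q : ℕ, q.Prime → q % 4 = 3 → q ∣ z → Even (z.factorization q)) ∧
        ((∃ c : ℕ, z = c ^ 2) → ∃ p : ℕ, p.Prime ∧ p % 4 = 1 ∧ p ∣ z)) := by
  constructor
  · rintro ⟨x, y, hx, hy, h⟩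
    have hn : z = x.natAbs ^ 2 + y.natAbs ^ 2 := by
      zify
      simpa only [sq_abs] using h
    refine ⟨fun q hq h3 hqz => ?_, ?_⟩
    · rw [Nat.factorization_def z hq]
      exact Nat.eq_sq_add_sq_iff.mp ⟨_, _, hn⟩ q (Nat.mem_primeFactors.mpr ⟨hq, hqz, hz.ne'⟩) h3
    · rintro ⟨c, rfl⟩
      obtain ⟨p, hp, h1, hpc⟩ := exists_prime_mod_four_eq_one_of_sq_eq_sq_add_sq
        (Int.natAbs_ne_zero.mpr hx) (Int.natAbs_ne_zero.mpr hy) hn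
      exact ⟨p, hp, h1, dvd_pow hpc two_ne_zero⟩
  · rintro ⟨heven, hsq⟩
    by_cases hc : ∃ c : ℕ, z = c ^ 2
    · obtain ⟨p, hp, h1, hpz⟩ := hsq hc
      obtain ⟨c, rfl⟩ := hc
      obtain ⟨k, rfl⟩ := hp.dvd_of_dvd_pow hpz
      obtain ⟨x, y, hx, hy, h⟩ := hp.exists_sq_eq_sq_add_sq h1
      have hk : (k : ℤ) ≠ 0 := by
        rintro hk
        simp_all
      exact ⟨x * k, y * k, mul_ne_zero hx hk, mul_ne_zero hy hk, by
        push_cast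
        rw [mul_pow, h]
        ring⟩
    · obtain ⟨x, y, h⟩ := Nat.eq_sq_add_sq_iff.mpr fun q hq h3 => by
        have hq' := Nat.prime_of_mem_primeFactors hq
        rw [← Nat.factorization_def z hq']
        exact heven q hq' h3 (Nat.dvd_of_mem_primeFactors hq)
      refine ⟨x, y, ?_, ?_, by exact_mod_cast h⟩
      · intro hx
        exact hc ⟨y, by simp_all⟩
      · intro hy
        exact hc ⟨x, by simp_all⟩
end

section
/- Let p be a prime with p ≡ 1 (mod 4), let a ≥ 1 be an integer, and let z be any integer. Then there exist integers x and y such that x^2 + y^2 ≡ z (mod p^a) and y^2 ≢ 0 (mod p^a). -/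
/-- If `p ≡ 1 (mod 4)` is prime, then `-1` is a square modulo every power of `p`. -/
theorem exists_pow_dvd_sq_add_one (p : ℕ) (hp : p.Prime) (hp1 : p % 4 = 1) (a : ℕ) :
    ∃ j : ℤ, (p : ℤ) ^ (a + 1) ∣ j ^ 2 + 1 := by
  have := Fact.mk hp
  obtain ⟨g, hg⟩ := ZMod.exists_sq_eq_neg_one_iff.mpr (show p % 4 ≠ 3 by omega)
  obtain ⟨n, rfl⟩ := ZMod.intCast_surjective g
  have h : (p : ℤ) ∣ n ^ 2 - (-1) := by
    rw [← ZMod.intCast_zmod_eq_zero_iff_dvd _ p]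
    push_cast
    rw [hg]
    ring
  have hodd : Odd (p ^ a) := (Nat.odd_iff.mpr (by omega)).pow
  have hpow := dvd_sub_pow_of_dvd_sub (p := p) h a
  rw [hodd.neg_one_pow, sub_neg_eq_add, ← pow_mul, mul_comm, pow_mul] at hpow
  exact ⟨n ^ p ^ a, hpow⟩

/-- If `p ≡ 1 (mod 4)` is prime and `a ≥ 1`, then every integer `z` is a sum of two squares
modulo `p^a`, where the second square can be taken nonzero modulo `p^a`. -/
theorem sum_two_squares_mod_prime_pow_one_mod_four (p : ℕ) (hp : p.Prime) (hp1 : p % 4 = 1)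
    (a : ℕ) (ha : 1 ≤ a) (z : ℤ) :
    ∃ x y : ℤ, x ^ 2 + y ^ 2 ≡ z [ZMOD ((p : ℤ) ^ a)] ∧ ¬ y ^ 2 ≡ 0 [ZMOD ((p : ℤ) ^ a)] := by
  have hpZ : Prime (p : ℤ) := Nat.prime_iff_prime_int.mp hp
  have hpP : (p : ℤ) ∣ (p : ℤ) ^ a := dvd_pow_self _ (by omega)
  obtain ⟨j, hj⟩ : ∃ j : ℤ, (p : ℤ) ^ a ∣ j ^ 2 + 1 := by
    obtain ⟨b, rfl⟩ := Nat.exists_eq_add_of_le' ha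
    exact exists_pow_dvd_sq_add_one p hp hp1 b
  obtain ⟨h, hh⟩ : ∃ h : ℤ, 2 * h = (p : ℤ) ^ a + 1 := by
    have hodd : Odd ((p : ℤ) ^ a) := Odd.pow (Int.odd_iff.mpr (by omega))
    obtain ⟨k, hk⟩ := hodd
    exact ⟨k + 1, by rw [hk]; ring⟩
  generalize (p : ℤ) ^ a = P at *
  have hpj : ¬ (p : ℤ) ∣ j := fun hd => hpZ.not_dvd_one <| by
    simpa using dvd_sub (hpP.trans hj) (dvd_pow hd two_ne_zero)
  have hph : ¬ (p : ℤ) ∣ h := fun hd => hpZ.not_dvd_one <| by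
    simpa [hh] using dvd_sub (hd.mul_left 2) hpP
  obtain ⟨c, hc⟩ := hj
  -- Over a ring with a square root `j` of `-1`, `x ^ 2 + y ^ 2` factors as a product `u * v`.
  have key (u v : ℤ) (huv : P ∣ z - u * v) (hne : ¬ (p : ℤ) ∣ u - v) :
      ∃ x y : ℤ, x ^ 2 + y ^ 2 ≡ z [ZMOD P] ∧ ¬ y ^ 2 ≡ 0 [ZMOD P] := by
    refine ⟨(u + v) * h, (u - v) * h * j, ?_, fun hy => ?_⟩
    · rw [Int.modEq_iff_dvd]
      obtain ⟨d, hd⟩ := huv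
      refine ⟨d - u * v * (P + 2) - (u - v) ^ 2 * h ^ 2 * c, ?_⟩
      linear_combination hd - (u - v) ^ 2 * h ^ 2 * hc - u * v * (2 * h + P + 1) * hh
    · have hy' := hpZ.dvd_of_dvd_pow (hpP.trans (Int.modEq_zero_iff_dvd.mp hy))
      rcases hpZ.dvd_or_dvd hy' with hy' | hy'
      · exact (hpZ.dvd_or_dvd hy').elim hne hph
      · exact hpj hy'
  by_cases hz : (p : ℤ) ∣ 1 - z
  · refine key 2 (h * z) ⟨-z, by linear_combination -z * hh⟩ fun hd => ?_
    have h3 : (p : ℤ) ∣ 3 := by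
      have := dvd_sub (dvd_add (hd.mul_left 2) (hpP.mul_right z)) hz
      rwa [show 2 * (2 - h * z) + P * z - (1 - z) = 3 by linear_combination -z * hh] at this
    have h3' : p ∣ 3 := by exact_mod_cast h3
    have := (Nat.prime_dvd_prime_iff_eq hp Nat.prime_three).mp h3'
    omega
  · exact key 1 z (by simp) hz
end

section
/- Let k ≥ 3 be an integer. Then for every integer z there exist integers x and y such that x^2 + y^2 ≡ z (mod 5^k), x^2 ≢ 0 (mod 5^k), and y^2 ≢ 0 (mod 5^k). -/
/-- `-1` is a square modulo every power of `5`. -/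
theorem five_pow_dvd_sq_add_one (k : ℕ) : ∃ i : ℤ, (5 : ℤ) ^ k ∣ i ^ 2 + 1 := by
  refine ⟨2 ^ 5 ^ k, ?_⟩
  have h : (5 : ℤ) ^ (k + 1) ∣ 4 ^ 5 ^ k - (-1) ^ 5 ^ k := by
    exact_mod_cast dvd_sub_pow_of_dvd_sub (R := ℤ) (p := 5) (a := 4) (b := -1) (by norm_num) k
  have hodd : Odd (5 ^ k) := Odd.pow (by decide)
  rw [hodd.neg_one_pow, sub_neg_eq_add] at h
  rw [← pow_mul, mul_comm, pow_mul]
  exact (pow_dvd_pow 5 k.le_succ).trans (by simpa using h)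

theorem twenty_five_dvd_of_dvd_sq {x : ℤ} (h : 125 ∣ x ^ 2) : 25 ∣ x := by
  have h5 : Prime (5 : ℤ) := by norm_num
  obtain ⟨c, rfl⟩ : 5 ∣ x := h5.dvd_of_dvd_pow ((by norm_num : (5 : ℤ) ∣ 125).trans h)
  have hc : (5 : ℤ) ∣ c ^ 2 := by
    rw [mul_pow] at h
    omega
  have := h5.dvd_of_dvd_pow hc
  omega

theorem sum_two_nonzero_squares_of_factorization {n h i u v z : ℤ} (hn : 125 ∣ n)
    (hh : 2 * h = n + 1) (hi : n ∣ i ^ 2 + 1) (huv : u * v ≡ z [ZMOD n])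
    (hadd : ¬ 25 ∣ u + v) (hsub : ¬ 25 ∣ u - v) :
    ∃ x y : ℤ, x ^ 2 + y ^ 2 ≡ z [ZMOD n] ∧
      ¬ x ^ 2 ≡ 0 [ZMOD n] ∧ ¬ y ^ 2 ≡ 0 [ZMOD n] := by
  have h25 : 25 ∣ n := (by norm_num : (25 : ℤ) ∣ 125).trans hn
  have half {w : ℤ} (hw : 25 ∣ h * w) : 25 ∣ w := by
    have := (hw.mul_left 2).sub (h25.mul_right w)
    rwa [show 2 * (h * w) - n * w = w by linear_combination w * hh] at this
  refine ⟨h * (u + v), i * (h * (u - v)), ?_, fun hx => hadd ?_, fun hy => hsub ?_⟩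
  · refine Int.ModEq.trans ?_ huv
    obtain ⟨m, hm⟩ := hi
    refine (Int.modEq_iff_dvd.2 ⟨m * (h * (u - v)) ^ 2 + (n + 2) * (u * v), ?_⟩).symm
    linear_combination (h * (u - v)) ^ 2 * hm + u * v * (2 * h + n + 1) * hh
  · exact half (twenty_five_dvd_of_dvd_sq (hn.trans (Int.modEq_zero_iff_dvd.1 hx)))
  · have hy' := twenty_five_dvd_of_dvd_sq (hn.trans (Int.modEq_zero_iff_dvd.1 hy))
    refine half ?_
    have := ((h25.trans hi).mul_right (h * (u - v))).sub (hy'.mul_left i)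
    rwa [show (i ^ 2 + 1) * (h * (u - v)) - i * (i * (h * (u - v))) = h * (u - v) by ring]
      at this

/-- For `k ≥ 3`, every integer `z` admits a nontrivial representation as a sum of two squares
modulo `5^k`. -/
theorem sum_two_nonzero_squares_mod_five_pow (k : ℕ) (hk : 3 ≤ k) (z : ℤ) :
    ∃ x y : ℤ, x ^ 2 + y ^ 2 ≡ z [ZMOD ((5 : ℤ) ^ k)] ∧
      ¬ x ^ 2 ≡ 0 [ZMOD ((5 : ℤ) ^ k)] ∧ ¬ y ^ 2 ≡ 0 [ZMOD ((5 : ℤ) ^ k)] := by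
  obtain ⟨i, hi⟩ := five_pow_dvd_sq_add_one k
  have hn : (125 : ℤ) ∣ 5 ^ k := by simpa using pow_dvd_pow (5 : ℤ) hk
  have hodd : Odd ((5 : ℤ) ^ k) := Odd.pow (by decide)
  generalize (5 : ℤ) ^ k = n at *
  obtain ⟨h, hh⟩ := hodd.add_one.two_dvd
  by_cases hz : 25 ∣ 1 + z ∨ 25 ∣ 1 - z
  · have h2 : 2 * (h * z) = n * z + z := by linear_combination -z * hh
    have hnz : 125 ∣ n * z := hn.mul_right z
    refine sum_two_nonzero_squares_of_factorization (u := 2) (v := h * z) hn hh.symm hi ?_ ?_ ?_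
    · rw [h2]
      exact (Int.modEq_iff_dvd.2 ⟨z, by ring⟩ : z ≡ n * z + z [ZMOD n]).symm
    · omega
    · omega
  · rw [not_or] at hz
    exact sum_two_nonzero_squares_of_factorization (u := 1) (v := z) hn hh.symm hi
      (by rw [one_mul]) hz.1 hz.2
end

section
/- Let n ≥ 2 be an integer. Then every residue class z modulo n can be written as z ≡ x^2 + y^2 (mod n) with x^2 ≢ 0 (mod n) and y^2 ≢ 0 (mod n) if and only if all of the following hold: (1) n is not divisible by q^2 for any prime q with q ≡ 3 (mod 4); (2) n is not divisible by 4; (3) n is divisible by some prime p with p ≡ 1 (mod 4); and (4) if n is odd, then writing n = 5^k · m with m not divisible by 5, either k ≥ 3, or k < 3 and m is divisible by some prime p with p ≡ 1 (mod 4). -/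
/-- Every integer is a sum of two squares modulo `n`. -/
def EverySumTwoSquaresMod (n : ℕ) : Prop :=
  ∀ z : ℤ, ∃ x y : ℤ, (n : ℤ) ∣ x ^ 2 + y ^ 2 - z

/-- Every integer is a sum of two squares modulo `n`, neither of which vanishes modulo `n`. -/
def EverySumTwoNonzeroSquaresMod (n : ℕ) : Prop :=
  ∀ z : ℤ, ∃ x y : ℤ, (n : ℤ) ∣ x ^ 2 + y ^ 2 - z ∧ ¬ (n : ℤ) ∣ x ^ 2 ∧ ¬ (n : ℤ) ∣ y ^ 2

theorem exists_dvd_sub_and_dvd_sub {a b : ℤ} (h : IsCoprime a b) (s t : ℤ) :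
    ∃ x : ℤ, a ∣ x - s ∧ b ∣ x - t := by
  obtain ⟨u, v, huv⟩ := h
  refine ⟨s * v * b + t * u * a, ⟨u * (t - s), ?_⟩, ⟨v * (s - t), ?_⟩⟩
  · linear_combination s * huv
  · linear_combination t * huv

theorem dvd_sq_add_sq_sub_of_dvd_sub {a x y s t z : ℤ} (hx : a ∣ x - s) (hy : a ∣ y - t)
    (h : a ∣ s ^ 2 + t ^ 2 - z) : a ∣ x ^ 2 + y ^ 2 - z := by
  have : x ^ 2 + y ^ 2 - z = (x - s) * (x + s) + (y - t) * (y + t) + (s ^ 2 + t ^ 2 - z) := by ring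
  rw [this]
  exact dvd_add (dvd_add (hx.mul_right _) (hy.mul_right _)) h

theorem dvd_sq_iff_of_dvd_sub {a x s : ℤ} (hx : a ∣ x - s) : a ∣ x ^ 2 ↔ a ∣ s ^ 2 := by
  refine (dvd_iff_dvd_of_dvd_sub ?_)
  have : x ^ 2 - s ^ 2 = (x - s) * (x + s) := by ring
  rw [this]
  exact hx.mul_right _

theorem EverySumTwoSquaresMod.mul {a b : ℕ} (hab : a.Coprime b) (ha : EverySumTwoSquaresMod a)
    (hb : EverySumTwoSquaresMod b) : EverySumTwoSquaresMod (a * b) := by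
  intro z
  have hc : IsCoprime (a : ℤ) b := Nat.isCoprime_iff_coprime.mpr hab
  obtain ⟨x₁, y₁, h₁⟩ := ha z
  obtain ⟨x₂, y₂, h₂⟩ := hb z
  obtain ⟨x, hxa, hxb⟩ := exists_dvd_sub_and_dvd_sub hc x₁ x₂
  obtain ⟨y, hya, hyb⟩ := exists_dvd_sub_and_dvd_sub hc y₁ y₂
  refine ⟨x, y, ?_⟩
  push_cast
  exact hc.mul_dvd (dvd_sq_add_sq_sub_of_dvd_sub hxa hya h₁)
    (dvd_sq_add_sq_sub_of_dvd_sub hxb hyb h₂)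

theorem EverySumTwoNonzeroSquaresMod.mul {a b : ℕ} (hab : a.Coprime b)
    (ha : EverySumTwoNonzeroSquaresMod a) (hb : EverySumTwoSquaresMod b) :
    EverySumTwoNonzeroSquaresMod (a * b) := by
  intro z
  have hc : IsCoprime (a : ℤ) b := Nat.isCoprime_iff_coprime.mpr hab
  obtain ⟨x₁, y₁, h₁, hx₁, hy₁⟩ := ha z
  obtain ⟨x₂, y₂, h₂⟩ := hb z
  obtain ⟨x, hxa, hxb⟩ := exists_dvd_sub_and_dvd_sub hc x₁ x₂
  obtain ⟨y, hya, hyb⟩ := exists_dvd_sub_and_dvd_sub hc y₁ y₂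
  push_cast
  refine ⟨x, y, hc.mul_dvd (dvd_sq_add_sq_sub_of_dvd_sub hxa hya h₁)
    (dvd_sq_add_sq_sub_of_dvd_sub hxb hyb h₂), fun h => hx₁ ?_, fun h => hy₁ ?_⟩
  · exact (dvd_sq_iff_of_dvd_sub hxa).1 ((dvd_mul_right _ _).trans h)
  · exact (dvd_sq_iff_of_dvd_sub hya).1 ((dvd_mul_right _ _).trans h)

/-- For odd `N`, it is enough that one of the two squares be nonzero modulo `N` in order that
both can be made nonzero modulo `2 * N`. -/
theorem everySumTwoNonzeroSquaresMod_two_mul {N : ℕ} (hN : Odd N)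
    (h : ∀ z : ℤ, ∃ x y : ℤ, (N : ℤ) ∣ x ^ 2 + y ^ 2 - z ∧ ¬ (N : ℤ) ∣ y ^ 2) :
    EverySumTwoNonzeroSquaresMod (2 * N) := by
  intro z
  have hc : IsCoprime (2 : ℤ) N := by
    exact_mod_cast Nat.isCoprime_iff_coprime.mpr (Nat.coprime_two_left.mpr hN)
  obtain ⟨s, t, hst, ht⟩ := h z
  obtain ⟨x, hx2, hxN⟩ := exists_dvd_sub_and_dvd_sub hc 1 s
  obtain ⟨y, hy2, hyN⟩ := exists_dvd_sub_and_dvd_sub hc (z - 1) t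
  push_cast
  refine ⟨x, y, hc.mul_dvd ?_ (dvd_sq_add_sq_sub_of_dvd_sub hxN hyN hst), fun h => ?_, fun h => ?_⟩
  · refine dvd_sq_add_sq_sub_of_dvd_sub hx2 hy2 ?_
    have : (1 : ℤ) ^ 2 + (z - 1) ^ 2 - z = (z - 1) * (z - 1 - 1) := by ring
    rw [this, mul_comm]
    simpa using (Int.even_mul_succ_self (z - 1 - 1)).two_dvd
  · have := (dvd_sq_iff_of_dvd_sub hx2).1 ((dvd_mul_right _ _).trans h)
    norm_num at this
  · exact ht ((dvd_sq_iff_of_dvd_sub hyN).1 ((dvd_mul_left _ _).trans h))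

/-- Given a square root `i` of `-1` modulo an odd number `N` and `u` invertible modulo `N`,
the factorization `z = u * (z / u)` gives a representation of `z` as a sum of two squares. -/
theorem exists_sq_add_sq_of_sq_eq_neg_one {N i u : ℤ} (hi : N ∣ i ^ 2 + 1)
    (hu : IsCoprime N (2 * u)) (z : ℤ) :
    ∃ x y : ℤ, N ∣ x ^ 2 + y ^ 2 - z ∧ (∀ d, d ∣ N → d ∣ x → d ∣ u ^ 2 + z) ∧
      (∀ d, d ∣ N → d ∣ y → d ∣ u ^ 2 - z) := by
  obtain ⟨v, w, hw⟩ := hu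
  obtain ⟨c, hc⟩ := hi
  refine ⟨(u ^ 2 + z) * w, (u ^ 2 - z) * w * i, ?_, ?_, ?_⟩
  · refine ⟨c * (u ^ 2 - z) ^ 2 * w ^ 2 - z * v * (1 + 2 * u * w), ?_⟩
    linear_combination ((u ^ 2 - z) ^ 2 * w ^ 2) * hc + (z * (1 + 2 * u * w)) * hw
  · rintro d ⟨e, he⟩ ⟨f, hf⟩
    refine ⟨(u ^ 2 + z) * v * e + 2 * u * f, ?_⟩
    linear_combination (-(u ^ 2 + z)) * hw + (u ^ 2 + z) * v * he + 2 * u * hf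
  · rintro d ⟨e, he⟩ ⟨f, hf⟩
    refine ⟨(u ^ 2 - z) * (v * e + 2 * u * w * c * e) - 2 * u * i * f, ?_⟩
    linear_combination (-(u ^ 2 - z)) * hw + (u ^ 2 - z) * (v + 2 * u * w * c) * he
      + (u ^ 2 - z) * w * 2 * u * hc - 2 * u * i * hf

theorem exists_prime_pow_dvd_sq_add_one {p : ℕ} (hp : p.Prime) (h1 : p % 4 = 1) (k : ℕ) :
    ∃ i : ℤ, ((p ^ k : ℕ) : ℤ) ∣ i ^ 2 + 1 := by
  have := Fact.mk hp
  obtain ⟨r, hr⟩ := ZMod.exists_sq_eq_neg_one_iff.mpr (show p % 4 ≠ 3 by omega)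
  obtain ⟨j, rfl⟩ := ZMod.intCast_surjective r
  have hj : (p : ℤ) ∣ j ^ 2 - (-1) := by
    rw [← ZMod.intCast_zmod_eq_zero_iff_dvd]
    push_cast
    rw [hr]
    ring
  have h := dvd_sub_pow_of_dvd_sub hj k
  have hodd : Odd (p ^ k) := (Nat.odd_iff.mpr (by omega)).pow
  rw [hodd.neg_one_pow, sub_neg_eq_add] at h
  refine ⟨j ^ p ^ k, ?_⟩
  rw [← pow_mul, mul_comm, pow_mul]
  push_cast
  exact (pow_dvd_pow _ k.le_succ).trans h

theorem isCoprime_prime_pow_two_mul {p : ℕ} (hp : p.Prime) (h1 : p % 4 = 1) (k : ℕ) {u : ℕ}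
    (hu0 : u ≠ 0) (hu : u < p) : IsCoprime ((p ^ k : ℕ) : ℤ) (2 * (u : ℤ)) := by
  have : Nat.Coprime (p ^ k) (2 * u) := by
    refine Nat.Coprime.pow_left _ (Nat.Coprime.mul_right ?_ ?_)
    · exact Nat.coprime_two_right.mpr (Nat.odd_iff.mpr (by omega))
    · exact Nat.coprime_of_lt_prime hu0 hu hp
  exact_mod_cast Nat.isCoprime_iff_coprime.mpr this

theorem everySumTwoSquaresMod_prime_pow {p : ℕ} (hp : p.Prime) (h1 : p % 4 = 1) (k : ℕ) :
    EverySumTwoSquaresMod (p ^ k) := by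
  intro z
  obtain ⟨i, hi⟩ := exists_prime_pow_dvd_sq_add_one hp h1 k
  obtain ⟨x, y, h, -⟩ := exists_sq_add_sq_of_sq_eq_neg_one hi
    (isCoprime_prime_pow_two_mul hp h1 k one_ne_zero hp.one_lt) z
  exact ⟨x, y, h⟩

theorem everySumTwoSquaresMod_prime {p : ℕ} (hp : p.Prime) : EverySumTwoSquaresMod p := by
  intro z
  have := Fact.mk hp
  obtain ⟨a, b, hab⟩ := ZMod.sq_add_sq p (z : ZMod p)
  obtain ⟨x, rfl⟩ := ZMod.intCast_surjective a
  obtain ⟨y, rfl⟩ := ZMod.intCast_surjective b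
  refine ⟨x, y, ?_⟩
  rw [← ZMod.intCast_zmod_eq_zero_iff_dvd]
  push_cast
  rw [hab, sub_self]

theorem everySumTwoSquaresMod_of_not_sq_dvd {n : ℕ} (hn : n ≠ 0)
    (h3 : ∀ q : ℕ, q.Prime → q % 4 = 3 → ¬ q ^ 2 ∣ n) (h4 : ¬ 4 ∣ n) :
    EverySumTwoSquaresMod n := by
  induction n using Nat.recOnPosPrimePosCoprime with
  | zero => exact absurd rfl hn
  | one => exact fun z => ⟨0, 0, by simp⟩
  | prime_pow p k hp hk =>
    by_cases h1 : p % 4 = 1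
    · exact everySumTwoSquaresMod_prime_pow hp h1 k
    have hk1 : ¬ 2 ≤ k := by
      intro hk2
      have hdvd := pow_dvd_pow p hk2
      rcases hp.eq_two_or_odd with rfl | hodd
      · exact h4 hdvd
      · exact h3 p hp (by omega) hdvd
    obtain rfl : k = 1 := by omega
    rw [pow_one]
    exact everySumTwoSquaresMod_prime hp
  | coprime a b ha hb hab iha ihb =>
    refine EverySumTwoSquaresMod.mul hab ?_ ?_
    · exact iha (by omega) (fun q hq hq3 h => h3 q hq hq3 (h.mul_right b))
        (fun h => h4 (h.mul_right b))
    · exact ihb (by omega) (fun q hq hq3 h => h3 q hq hq3 (h.mul_left a))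
        (fun h => h4 (h.mul_left a))

theorem exists_not_dvd_sq_add_and_not_dvd_sq_sub {d : ℤ} (h3 : ¬ d ∣ 3) (h5 : ¬ d ∣ 5)
    (h8 : ¬ d ∣ 8) (z : ℤ) :
    ∃ u : ℕ, u ≠ 0 ∧ u ≤ 3 ∧ ¬ d ∣ (u : ℤ) ^ 2 + z ∧ ¬ d ∣ (u : ℤ) ^ 2 - z := by
  by_contra! h
  have key (w : ℤ) (a b : ℤ) (ha : d ∣ a - w) (hb : d ∣ b - w) : d ∣ b - a := by
    have := dvd_sub hb ha
    rwa [sub_sub_sub_cancel_right] at this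
  have hu (u : ℕ) (h0 : u ≠ 0) (hu3 : u ≤ 3) :
      d ∣ (u : ℤ) ^ 2 - (-z) ∨ d ∣ (u : ℤ) ^ 2 - z := by
    rw [sub_neg_eq_add]
    exact or_iff_not_imp_left.mpr (h u h0 hu3)
  have e1 := hu 1 (by norm_num) (by norm_num)
  have e2 := hu 2 (by norm_num) (by norm_num)
  have e3 := hu 3 (by norm_num) (by norm_num)
  have k12 (w : ℤ) (ha : d ∣ ((1 : ℕ) : ℤ) ^ 2 - w) (hb : d ∣ ((2 : ℕ) : ℤ) ^ 2 - w) : False :=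
    h3 (by simpa using key w _ _ ha hb)
  have k13 (w : ℤ) (ha : d ∣ ((1 : ℕ) : ℤ) ^ 2 - w) (hb : d ∣ ((3 : ℕ) : ℤ) ^ 2 - w) : False :=
    h8 (by simpa using key w _ _ ha hb)
  have k23 (w : ℤ) (ha : d ∣ ((2 : ℕ) : ℤ) ^ 2 - w) (hb : d ∣ ((3 : ℕ) : ℤ) ^ 2 - w) : False :=
    h5 (by simpa using key w _ _ ha hb)
  rcases e1 with e1 | e1 <;> rcases e2 with e2 | e2 <;> rcases e3 with e3 | e3 <;>
    first
      | exact k12 _ e1 e2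
      | exact k13 _ e1 e3
      | exact k23 _ e2 e3

theorem everySumTwoNonzeroSquaresMod_prime_pow_of_dvd {p k : ℕ} (hp : p.Prime) (h1 : p % 4 = 1)
    {d : ℤ} (h3 : ¬ d ∣ 3) (h5 : ¬ d ∣ 5) (h8 : ¬ d ∣ 8) (hd : d ∣ ((p ^ k : ℕ) : ℤ))
    (hsq : ∀ x : ℤ, ((p ^ k : ℕ) : ℤ) ∣ x ^ 2 → d ∣ x) :
    EverySumTwoNonzeroSquaresMod (p ^ k) := by
  intro z
  obtain ⟨i, hi⟩ := exists_prime_pow_dvd_sq_add_one hp h1 k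
  obtain ⟨u, hu0, hu3, hadd, hsub⟩ := exists_not_dvd_sq_add_and_not_dvd_sq_sub h3 h5 h8 z
  have hp2 := hp.two_le
  obtain ⟨x, y, h, hx, hy⟩ := exists_sq_add_sq_of_sq_eq_neg_one hi
    (isCoprime_prime_pow_two_mul hp h1 k hu0 (by omega)) z
  exact ⟨x, y, h, fun hn => hadd (hx d hd (hsq x hn)), fun hn => hsub (hy d hd (hsq y hn))⟩

theorem everySumTwoNonzeroSquaresMod_prime_pow {p k : ℕ} (hp : p.Prime) (h1 : p % 4 = 1)
    (hp5 : p ≠ 5) (hk : k ≠ 0) : EverySumTwoNonzeroSquaresMod (p ^ k) := by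
  have hp2 := hp.two_le
  have hnd (c : ℕ) (hc0 : c ≠ 0) (hc : c ≤ 8) : ¬ (p : ℤ) ∣ (c : ℤ) := by
    rw [Int.natCast_dvd_natCast]
    intro h
    have := Nat.le_of_dvd (by omega) h
    obtain rfl : p = 5 := by omega
    exact hp5 rfl
  have hdvd : (p : ℤ) ∣ ((p ^ k : ℕ) : ℤ) := by exact_mod_cast dvd_pow_self p hk
  refine everySumTwoNonzeroSquaresMod_prime_pow_of_dvd hp h1 (hnd 3 (by norm_num) (by norm_num))
    (hnd 5 (by norm_num) (by norm_num)) (hnd 8 (by norm_num) le_rfl) hdvd fun x hx => ?_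
  exact (Nat.prime_iff_prime_int.mp hp).dvd_of_dvd_pow (hdvd.trans hx)

theorem twentyFive_dvd_of_dvd_sq {x : ℤ} (h : (125 : ℤ) ∣ x ^ 2) : 25 ∣ x := by
  have h5 : Prime (5 : ℤ) := Nat.prime_iff_prime_int.mp Nat.prime_five
  obtain ⟨y, rfl⟩ := h5.dvd_of_dvd_pow ((by norm_num : (5 : ℤ) ∣ 125).trans h)
  have hy : (5 : ℤ) ∣ y ^ 2 := by
    obtain ⟨c, hc⟩ := h
    exact ⟨c, by linarith⟩
  obtain ⟨w, rfl⟩ := h5.dvd_of_dvd_pow hy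
  exact ⟨w, by ring⟩

theorem everySumTwoNonzeroSquaresMod_five_pow {k : ℕ} (hk : 3 ≤ k) :
    EverySumTwoNonzeroSquaresMod (5 ^ k) := by
  have h125 : (125 : ℤ) ∣ ((5 ^ k : ℕ) : ℤ) := by exact_mod_cast pow_dvd_pow 5 hk
  exact everySumTwoNonzeroSquaresMod_prime_pow_of_dvd (d := 25) Nat.prime_five rfl
    (by norm_num) (by norm_num) (by norm_num) ((by norm_num : (25 : ℤ) ∣ 125).trans h125)
    fun x hx => twentyFive_dvd_of_dvd_sq (h125.trans hx)

theorem everySumTwoNonzeroSquaresMod_two_mul_five_pow {k : ℕ} (hk : k ≠ 0) :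
    EverySumTwoNonzeroSquaresMod (2 * 5 ^ k) := by
  refine everySumTwoNonzeroSquaresMod_two_mul (Odd.pow (by decide)) fun z => ?_
  obtain ⟨i, hi⟩ := exists_prime_pow_dvd_sq_add_one Nat.prime_five rfl k
  have hd : (5 : ℤ) ∣ ((5 ^ k : ℕ) : ℤ) := by exact_mod_cast dvd_pow_self 5 hk
  obtain ⟨u, hu0, hu5, hu⟩ : ∃ u : ℕ, u ≠ 0 ∧ u < 5 ∧ ¬ (5 : ℤ) ∣ (u : ℤ) ^ 2 - z := by
    by_cases h : (5 : ℤ) ∣ 1 - z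
    · exact ⟨2, by norm_num, by norm_num, by push_cast; omega⟩
    · exact ⟨1, by norm_num, by norm_num, by simpa using h⟩
  obtain ⟨x, y, h, -, hy⟩ := exists_sq_add_sq_of_sq_eq_neg_one hi
    (isCoprime_prime_pow_two_mul Nat.prime_five rfl k hu0 hu5) z
  refine ⟨x, y, h, fun hn => hu (hy 5 hd ?_)⟩
  exact (Nat.prime_iff_prime_int.mp Nat.prime_five).dvd_of_dvd_pow (hd.trans hn)

theorem everySumTwoNonzeroSquaresMod_of_conditions {n : ℕ} (hn : n ≠ 0)
    (h3 : ∀ q : ℕ, q.Prime → q % 4 = 3 → ¬ q ^ 2 ∣ n) (h4 : ¬ 4 ∣ n)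
    (h1 : ∃ p : ℕ, p.Prime ∧ p % 4 = 1 ∧ p ∣ n)
    (h5 : Odd n → ∀ k m : ℕ, ¬ 5 ∣ m → n = 5 ^ k * m →
      (3 ≤ k ∨ (k < 3 ∧ ∃ p : ℕ, p.Prime ∧ p % 4 = 1 ∧ p ∣ m))) :
    EverySumTwoNonzeroSquaresMod n := by
  have hdvd (b : ℕ) (hb : b ∣ n) : EverySumTwoSquaresMod b :=
    everySumTwoSquaresMod_of_not_sq_dvd (ne_zero_of_dvd_ne_zero hn hb)
      (fun q hq hq3 h => h3 q hq hq3 (h.trans hb)) (fun h => h4 (h.trans hb))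
  by_cases hp5 : ∃ p : ℕ, p.Prime ∧ p % 4 = 1 ∧ p ∣ n ∧ p ≠ 5
  · obtain ⟨p, hp, hp1, hpn, hne⟩ := hp5
    obtain ⟨k, m, hm, rfl⟩ := Nat.exists_eq_pow_mul_and_not_dvd hn p hp.ne_one
    have hk : k ≠ 0 := by
      rintro rfl
      exact hm (by simpa using hpn)
    exact (everySumTwoNonzeroSquaresMod_prime_pow hp hp1 hne hk).mul
      (((Nat.Prime.coprime_iff_not_dvd hp).mpr hm).pow_left k) (hdvd m (dvd_mul_left _ _))
  push Not at hp5
  have h5n : 5 ∣ n := by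
    obtain ⟨p, hp, hp1, hpn⟩ := h1
    exact hp5 p hp hp1 hpn ▸ hpn
  obtain ⟨k, m, hm, rfl⟩ := Nat.exists_eq_pow_mul_and_not_dvd hn 5 (by norm_num)
  have hk : k ≠ 0 := by
    rintro rfl
    exact hm (by simpa using h5n)
  have hcop : (5 ^ k).Coprime m := ((Nat.Prime.coprime_iff_not_dvd Nat.prime_five).mpr hm).pow_left k
  rcases Nat.even_or_odd m with heven | hodd
  · obtain ⟨m', rfl⟩ := heven.two_dvd
    have hm' : Odd m' := by
      rw [← Nat.not_even_iff_odd]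
      rintro heven'
      obtain ⟨l, rfl⟩ := heven'.two_dvd
      exact h4 ⟨5 ^ k * l, by ring⟩
    rw [mul_left_comm, ← mul_assoc]
    exact (everySumTwoNonzeroSquaresMod_two_mul_five_pow hk).mul
      (Nat.Coprime.mul_left (Nat.coprime_two_left.mpr hm') (hcop.coprime_dvd_right
        (dvd_mul_left _ _))) (hdvd m' ⟨5 ^ k * 2, by ring⟩)
  · have hk3 : 3 ≤ k := by
      rcases h5 (Odd.mul (Odd.pow (by decide)) hodd) k m hm rfl with h | ⟨-, p, hp, hp1, hpm⟩
      · exact h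
      · exact absurd (hp5 p hp hp1 (hpm.mul_left _) ▸ hpm) hm
    exact (everySumTwoNonzeroSquaresMod_five_pow hk3).mul hcop (hdvd m (dvd_mul_left _ _))

theorem dvd_of_prime_mod_four_eq_three_dvd_sq_add_sq {q : ℕ} (hq : q.Prime) (h3 : q % 4 = 3)
    {x y : ℤ} (h : (q : ℤ) ∣ x ^ 2 + y ^ 2) : (q : ℤ) ∣ x := by
  have := Fact.mk hq
  by_contra hx
  rw [← ZMod.intCast_zmod_eq_zero_iff_dvd] at h hx
  push_cast at h
  exact ZMod.mod_four_ne_three_of_sq_eq_neg_sq' hx (eq_neg_of_add_eq_zero_right h) h3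

theorem dvd_of_squarefree_dvd_sq_add_sq {m : ℕ} (hm : Squarefree m)
    (h3 : ∀ q : ℕ, q.Prime → q ∣ m → q % 4 = 3) {x y : ℤ} (h : (m : ℤ) ∣ x ^ 2 + y ^ 2) :
    (m : ℤ) ∣ x := by
  rw [Int.natCast_dvd, ← Nat.prod_primeFactors_of_squarefree hm]
  refine Finset.prod_primes_dvd _ (fun q hq => (Nat.prime_of_mem_primeFactors hq).prime)
    fun q hq => ?_
  have hqp := Nat.prime_of_mem_primeFactors hq
  have hqm := Nat.dvd_of_mem_primeFactors hq
  rw [← Int.natCast_dvd]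
  exact dvd_of_prime_mod_four_eq_three_dvd_sq_add_sq hqp (h3 q hqp hqm)
    ((Int.natCast_dvd_natCast.mpr hqm).trans h)

/-- An odd `m` without prime factors that are `1` modulo `4` and not divisible by the square of
a prime that is `3` modulo `4` divides `x` and `y` as soon as it divides `x ^ 2 + y ^ 2`. -/
theorem dvd_and_dvd_of_dvd_sq_add_sq {m : ℕ} (hm : Odd m)
    (h3 : ∀ q : ℕ, q.Prime → q % 4 = 3 → ¬ q ^ 2 ∣ m)
    (h1 : ¬ ∃ p : ℕ, p.Prime ∧ p % 4 = 1 ∧ p ∣ m) {x y : ℤ} (h : (m : ℤ) ∣ x ^ 2 + y ^ 2) :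
    (m : ℤ) ∣ x ∧ (m : ℤ) ∣ y := by
  have hq3 (q : ℕ) (hq : q.Prime) (hqm : q ∣ m) : q % 4 = 3 := by
    have hodd := Nat.odd_iff.mp (hm.of_dvd_nat hqm)
    have : q % 4 ≠ 1 := fun hq1 => h1 ⟨q, hq, hq1, hqm⟩
    omega
  have hsf : Squarefree m := by
    rw [Nat.squarefree_iff_prime_squarefree]
    intro q hq hqq
    exact h3 q hq (hq3 q hq ((dvd_mul_right q q).trans hqq)) (by rwa [sq])
  exact ⟨dvd_of_squarefree_dvd_sq_add_sq hsf hq3 h,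
    dvd_of_squarefree_dvd_sq_add_sq hsf hq3 (by rwa [add_comm])⟩

namespace EverySumTwoSquaresMod

theorem not_sq_dvd {n q : ℕ} (h : EverySumTwoSquaresMod n) (hq : q.Prime) (h3 : q % 4 = 3) :
    ¬ q ^ 2 ∣ n := by
  intro hqn
  obtain ⟨x, y, hxy⟩ := h q
  have hd : (q : ℤ) ^ 2 ∣ x ^ 2 + y ^ 2 - q :=
    (by exact_mod_cast hqn : (q : ℤ) ^ 2 ∣ (n : ℤ)).trans hxy
  have hs : (q : ℤ) ∣ x ^ 2 + y ^ 2 :=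
    (dvd_iff_dvd_of_dvd_sub ((dvd_pow_self _ two_ne_zero).trans hd)).mpr dvd_rfl
  have hx := pow_dvd_pow_of_dvd (dvd_of_prime_mod_four_eq_three_dvd_sq_add_sq hq h3 hs) 2
  have hy := pow_dvd_pow_of_dvd (dvd_of_prime_mod_four_eq_three_dvd_sq_add_sq hq h3
    (by rwa [add_comm] at hs)) 2
  have hqq : (q : ℤ) ^ 2 ∣ q := (dvd_sub_right (dvd_add hx hy)).mp hd
  have := Nat.le_of_dvd hq.pos (by exact_mod_cast hqq : q ^ 2 ∣ q)
  nlinarith [hq.two_le]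

theorem not_four_dvd {n : ℕ} (h : EverySumTwoSquaresMod n) : ¬ 4 ∣ n := by
  intro h4
  obtain ⟨x, y, hxy⟩ := h 3
  have hd : (4 : ℤ) ∣ x ^ 2 + y ^ 2 - 3 := (by exact_mod_cast h4 : (4 : ℤ) ∣ (n : ℤ)).trans hxy
  have hsq (w : ℤ) : w ^ 2 % 4 = 0 ∨ w ^ 2 % 4 = 1 := by
    rcases Int.even_or_odd' w with ⟨c, rfl | rfl⟩ <;> ring_nf <;> omega
  have hx := hsq x
  have hy := hsq y
  omega

end EverySumTwoSquaresMod

namespace EverySumTwoNonzeroSquaresMod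

theorem everySumTwoSquaresMod {n : ℕ} (h : EverySumTwoNonzeroSquaresMod n) :
    EverySumTwoSquaresMod n := fun z =>
  let ⟨x, y, hxy, _⟩ := h z
  ⟨x, y, hxy⟩

theorem exists_prime_dvd_of_odd {k m : ℕ} (hm : Odd m) (hm5 : ¬ 5 ∣ m) (hk : k < 3)
    (h : EverySumTwoNonzeroSquaresMod (5 ^ k * m)) :
    ∃ p : ℕ, p.Prime ∧ p % 4 = 1 ∧ p ∣ m := by
  by_contra h1
  obtain ⟨x, y, hxy, hx, hy⟩ := h ((m : ℤ) ^ 4)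
  have h3 (q : ℕ) (hq : q.Prime) (hq3 : q % 4 = 3) : ¬ q ^ 2 ∣ m := fun hqm =>
    h.everySumTwoSquaresMod.not_sq_dvd hq hq3 (hqm.mul_left _)
  push_cast at hxy hx hy
  have hms : (m : ℤ) ∣ x ^ 2 + y ^ 2 :=
    (dvd_iff_dvd_of_dvd_sub ((dvd_mul_left _ _).trans hxy)).mpr (dvd_pow_self _ (by norm_num))
  obtain ⟨hmx, hmy⟩ := dvd_and_dvd_of_dvd_sq_add_sq hm h3 h1 hms
  have hcop : IsCoprime ((5 : ℤ) ^ k) m := by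
    refine IsCoprime.pow_left ?_
    exact_mod_cast Nat.isCoprime_iff_coprime.mpr
      ((Nat.Prime.coprime_iff_not_dvd Nat.prime_five).mpr hm5)
  have h5 (w : ℤ) (hmw : (m : ℤ) ∣ w) (hw : ¬ (5 : ℤ) ^ k * m ∣ w ^ 2) : ¬ (5 : ℤ) ∣ w := by
    intro h5w
    refine hw (hcop.mul_dvd ?_ (hmw.trans (dvd_pow_self _ two_ne_zero)))
    exact (pow_dvd_pow _ (by omega : k ≤ 2)).trans (pow_dvd_pow_of_dvd h5w 2)
  have hk0 : k ≠ 0 := by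
    rintro rfl
    exact hx (by simpa using hmx.trans (dvd_pow_self x two_ne_zero))
  have hd : (5 : ℤ) ∣ x ^ 2 + y ^ 2 - (m : ℤ) ^ 4 :=
    ((dvd_pow_self 5 hk0).mul_right _).trans hxy
  have hsq (w : ℤ) (hw : ¬ (5 : ℤ) ∣ w) : w ^ 2 % 5 = 1 ∨ w ^ 2 % 5 = 4 := by
    have : w % 5 = 1 ∨ w % 5 = 2 ∨ w % 5 = 3 ∨ w % 5 = 4 := by omega
    rcases this with h | h | h | h <;> simp [pow_two, Int.mul_emod, h]
  have hm4 : (m : ℤ) ^ 4 % 5 = 1 := by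
    have : (m : ℤ) ^ 4 = (m : ℤ) ^ 2 * (m : ℤ) ^ 2 := by ring
    rcases hsq m (by exact_mod_cast hm5) with h | h <;> rw [this, Int.mul_emod, h] <;> norm_num
  have hx5 := hsq x (h5 x hmx hx)
  have hy5 := hsq y (h5 y hmy hy)
  omega

theorem exists_prime_dvd {n : ℕ} (hn : n ≠ 0) (h : EverySumTwoNonzeroSquaresMod n) :
    ∃ p : ℕ, p.Prime ∧ p % 4 = 1 ∧ p ∣ n := by
  rcases Nat.even_or_odd n with heven | hodd
  · obtain ⟨m, rfl⟩ := heven.two_dvd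
    have hm : Odd m := by
      rw [← Nat.not_even_iff_odd]
      intro hm
      obtain ⟨l, rfl⟩ := hm.two_dvd
      exact h.everySumTwoSquaresMod.not_four_dvd ⟨l, by ring⟩
    by_contra! h1
    obtain ⟨x, y, hxy, hx, hy⟩ := h m
    have h3 (q : ℕ) (hq : q.Prime) (hq3 : q % 4 = 3) : ¬ q ^ 2 ∣ m := fun hqm =>
      h.everySumTwoSquaresMod.not_sq_dvd hq hq3 (hqm.mul_left _)
    push_cast at hxy hx hy
    have hms : (m : ℤ) ∣ x ^ 2 + y ^ 2 :=
      (dvd_iff_dvd_of_dvd_sub ((dvd_mul_left _ _).trans hxy)).mpr dvd_rfl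
    obtain ⟨hmx, hmy⟩ := dvd_and_dvd_of_dvd_sq_add_sq hm h3
      (fun ⟨p, hp, hp1, hpm⟩ => h1 p hp hp1 (hpm.mul_left _)) hms
    have hcop : IsCoprime (2 : ℤ) m := by
      exact_mod_cast Nat.isCoprime_iff_coprime.mpr (Nat.coprime_two_left.mpr hm)
    have hodd (w : ℤ) (hmw : (m : ℤ) ∣ w) (hw : ¬ 2 * (m : ℤ) ∣ w ^ 2) : Odd (w ^ 2) := by
      rw [← Int.not_even_iff_odd]
      intro he
      exact hw (hcop.mul_dvd he.two_dvd (hmw.trans (dvd_pow_self _ two_ne_zero)))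
    have heven : Even (x ^ 2 + y ^ 2 - (m : ℤ)) :=
      even_iff_two_dvd.mpr ((dvd_mul_right _ _).trans hxy)
    have hodd' : Odd (x ^ 2 + y ^ 2 - (m : ℤ)) :=
      ((hodd x hmx hx).add_odd (hodd y hmy hy)).sub_odd (by exact_mod_cast hm)
    exact Int.not_even_iff_odd.mpr hodd' heven
  · by_cases h5 : 5 ∣ n
    · exact ⟨5, Nat.prime_five, rfl, h5⟩
    · exact exists_prime_dvd_of_odd (k := 0) hodd h5 (by norm_num) (by simpa using h)

end EverySumTwoNonzeroSquaresMod

/-- Characterization of the integers `n ≥ 2` such that every residue class modulo `n` is a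
sum of two squares, each nonzero modulo `n`. -/
theorem forall_sum_two_nonzero_squares_mod_iff (n : ℕ) (hn : 2 ≤ n) :
    (∀ z : ℤ, ∃ x y : ℤ, x ^ 2 + y ^ 2 ≡ z [ZMOD (n : ℤ)] ∧
        ¬ x ^ 2 ≡ 0 [ZMOD (n : ℤ)] ∧ ¬ y ^ 2 ≡ 0 [ZMOD (n : ℤ)]) ↔
      ((∀ q : ℕ, q.Prime → q % 4 = 3 → ¬ q ^ 2 ∣ n) ∧
        ¬ 4 ∣ n ∧
        (∃ p : ℕ, p.Prime ∧ p % 4 = 1 ∧ p ∣ n) ∧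
        (Odd n → ∀ k m : ℕ, ¬ 5 ∣ m → n = 5 ^ k * m →
          (3 ≤ k ∨ (k < 3 ∧ ∃ p : ℕ, p.Prime ∧ p % 4 = 1 ∧ p ∣ m)))) := by
  have hdef : (∀ z : ℤ, ∃ x y : ℤ, x ^ 2 + y ^ 2 ≡ z [ZMOD (n : ℤ)] ∧
      ¬ x ^ 2 ≡ 0 [ZMOD (n : ℤ)] ∧ ¬ y ^ 2 ≡ 0 [ZMOD (n : ℤ)]) ↔
      EverySumTwoNonzeroSquaresMod n := by
    simp only [EverySumTwoNonzeroSquaresMod, Int.modEq_iff_dvd, zero_sub, dvd_neg, dvd_sub_comm]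
  rw [hdef]
  refine ⟨fun h => ⟨fun q hq hq3 => h.everySumTwoSquaresMod.not_sq_dvd hq hq3,
    h.everySumTwoSquaresMod.not_four_dvd, h.exists_prime_dvd (by omega), ?_⟩,
    fun ⟨h3, h4, h1, h5⟩ => everySumTwoNonzeroSquaresMod_of_conditions (by omega) h3 h4 h1 h5⟩
  rintro hodd k m hm rfl
  refine or_iff_not_imp_left.mpr fun hk => ⟨by omega, ?_⟩
  exact EverySumTwoNonzeroSquaresMod.exists_prime_dvd_of_odd (Nat.odd_mul.mp hodd).2 hm
    (by omega) h
end
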